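/- Let 𝒥 satisfy 𝒥(z) ≤ c|z|^{−N−γ} for |z| > 1 with 0 < γ < 2, together with the Lévy and radial monotonicity assumptions. Let ψ be a C² radially nonincreasing function with ψ(z) = 1 for |z| ≤ 1 and ψ(z) = |z|^{−N−γ} for |z| ≥ 2, and for A > 2 set φ(x) = ψ(x/A). Then |ℒφ(x)| ≤ C A^{−γ} φ(x) for all x ∈ ℝᴺ, with C independent of A. -/

import Mathlib

open MeasureTheory Set Filter

theorem pow_mul_rpow_sub_dim {N : ℕ} (hN : 1 ≤ N) (s : ℝ) {y : ℝ} (hy : 0 < y) :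
    y ^ (N - 1) * y ^ (s - N) = y ^ (s - 1) := by
  rw [← Real.rpow_natCast, ← Real.rpow_add hy, Nat.cast_sub hN]
  congr 1
  push_cast
  ring

/-- The tail integral of a supercritical negative power of the norm. -/
theorem exists_integral_norm_rpow_tail {N : ℕ} (hN : 1 ≤ N) {γ : ℝ} (hγ : 0 < γ) :
    ∃ K : ℝ, 0 ≤ K ∧ ∀ R : ℝ, 0 < R →
      Integrable (fun y : EuclideanSpace ℝ (Fin N) =>
        (Ioi R).indicator (fun r : ℝ => r ^ (-((N:ℝ) + γ))) ‖y‖) ∧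
      ∫ y : EuclideanSpace ℝ (Fin N), (Ioi R).indicator (fun r : ℝ => r ^ (-((N:ℝ) + γ))) ‖y‖
        = K * R ^ (-γ) := by
  have : Nonempty (Fin N) := ⟨⟨0, hN⟩⟩
  refine ⟨N * volume.real (Metric.ball (0 : EuclideanSpace ℝ (Fin N)) 1) * (1 / γ),
    by positivity, fun R hR => ?_⟩
  have key : EqOn (fun y : ℝ => y ^ (N - 1) • (Ioi R).indicator
      (fun r : ℝ => r ^ (-((N:ℝ) + γ))) y)
      ((Ioi R).indicator fun y : ℝ => y ^ (-γ - 1)) (Ioi 0) := by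
    intro y hy
    by_cases h : y ∈ Ioi R
    · simp only [indicator_of_mem h, smul_eq_mul]
      rw [← pow_mul_rpow_sub_dim hN (-γ) hy]
      ring_nf
    · simp [indicator_of_notMem h]
  have hpow_int : IntegrableOn (fun t : ℝ => t ^ (-γ - 1)) (Ioi R) :=
    integrableOn_Ioi_rpow_of_lt (by linarith) hR
  constructor
  · rw [integrable_fun_norm_addHaar volume
      (f := (Ioi R).indicator (fun r : ℝ => r ^ (-((N:ℝ) + γ)))), finrank_euclideanSpace_fin,
      integrableOn_congr_fun key measurableSet_Ioi]
    exact ((integrable_indicator_iff measurableSet_Ioi).2 hpow_int).integrableOn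
  · rw [integral_fun_norm_addHaar volume
      ((Ioi R).indicator (fun r : ℝ => r ^ (-((N:ℝ) + γ)))), finrank_euclideanSpace_fin,
      setIntegral_congr_fun measurableSet_Ioi key, setIntegral_indicator measurableSet_Ioi,
      Ioi_inter_Ioi, sup_eq_right.2 hR.le, integral_Ioi_rpow_of_lt (by linarith) hR]
    simp only [nsmul_eq_mul, smul_eq_mul, sub_add_cancel]
    field_simp

/-- The integral over a ball of a subcritical power of the norm. -/
theorem exists_integral_norm_rpow_ball {N : ℕ} (hN : 1 ≤ N) {γ : ℝ} (hγ2 : γ < 2) :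
    ∃ K : ℝ, 0 ≤ K ∧ ∀ R : ℝ, 0 < R →
      Integrable (fun y : EuclideanSpace ℝ (Fin N) =>
        (Iic R).indicator (fun r : ℝ => r ^ (2 - ((N:ℝ) + γ))) ‖y‖) ∧
      ∫ y : EuclideanSpace ℝ (Fin N), (Iic R).indicator (fun r : ℝ => r ^ (2 - ((N:ℝ) + γ))) ‖y‖
        = K * R ^ (2 - γ) := by
  have : Nonempty (Fin N) := ⟨⟨0, hN⟩⟩
  have h2 : 0 < 2 - γ := by linarith
  refine ⟨N * volume.real (Metric.ball (0 : EuclideanSpace ℝ (Fin N)) 1) * (1 / (2 - γ)),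
    by positivity, fun R hR => ?_⟩
  have key : EqOn (fun y : ℝ => y ^ (N - 1) • (Iic R).indicator
      (fun r : ℝ => r ^ (2 - ((N:ℝ) + γ))) y)
      ((Iic R).indicator fun y : ℝ => y ^ ((2 - γ) - 1)) (Ioi 0) := by
    intro y hy
    by_cases h : y ∈ Iic R
    · simp only [indicator_of_mem h, smul_eq_mul]
      rw [← pow_mul_rpow_sub_dim hN (2 - γ) hy]
      ring_nf
    · simp [indicator_of_notMem h]
  have hpow_int : IntegrableOn (fun t : ℝ => t ^ ((2 - γ) - 1)) (Ioc 0 R) :=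
    (intervalIntegrable_iff_integrableOn_Ioc_of_le hR.le).1
      (intervalIntegral.intervalIntegrable_rpow' (by linarith))
  constructor
  · rw [integrable_fun_norm_addHaar volume
      (f := (Iic R).indicator (fun r : ℝ => r ^ (2 - ((N:ℝ) + γ)))), finrank_euclideanSpace_fin,
      integrableOn_congr_fun key measurableSet_Ioi, IntegrableOn,
      integrable_indicator_iff measurableSet_Iic, IntegrableOn,
      Measure.restrict_restrict measurableSet_Iic, inter_comm, Ioi_inter_Iic]
    exact hpow_int
  · rw [integral_fun_norm_addHaar volume
      ((Iic R).indicator (fun r : ℝ => r ^ (2 - ((N:ℝ) + γ)))), finrank_euclideanSpace_fin,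
      setIntegral_congr_fun measurableSet_Ioi key, setIntegral_indicator measurableSet_Iic,
      Ioi_inter_Iic, ← intervalIntegral.integral_of_le hR.le,
      integral_rpow (Or.inl (by linarith))]
    simp only [nsmul_eq_mul, smul_eq_mul, sub_add_cancel]
    rw [Real.zero_rpow h2.ne']
    field_simp
    ring

theorem norm_fderiv_fderiv_eq_norm_iteratedFDeriv_two {E : Type*} [NormedAddCommGroup E]
    [NormedSpace ℝ E] (f : E → ℝ) (x : E) :
    ‖fderiv ℝ (fderiv ℝ f) x‖ = ‖iteratedFDeriv ℝ 2 f x‖ := by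
  rw [← norm_iteratedFDeriv_one, norm_iteratedFDeriv_fderiv]

/-- A symmetric second difference is controlled by a bound on the Hessian. -/
theorem abs_second_difference_le {E : Type*} [NormedAddCommGroup E] [NormedSpace ℝ E]
    {f : E → ℝ} (hf : ContDiff ℝ 2 f) {x : E} {ρ M : ℝ}
    (hM : ∀ w, ‖w - x‖ ≤ ρ → ‖iteratedFDeriv ℝ 2 f w‖ ≤ M) {h : E} (hh : ‖h‖ ≤ ρ) :
    |(f x - f (x - h)) + (f x - f (x + h))| ≤ 2 * M * ‖h‖ ^ 2 := by
  have hM0 : 0 ≤ M := (norm_nonneg _).trans (hM x (by simpa using (norm_nonneg h).trans hh))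
  have hd : Differentiable ℝ f := hf.differentiable (by norm_num)
  have hd2 : Differentiable ℝ (fderiv ℝ f) :=
    (hf.fderiv_right (m := 1) (by norm_num)).differentiable (by norm_num)
  have grad : ∀ w ∈ Metric.closedBall x ‖h‖, ‖fderiv ℝ f w - fderiv ℝ f x‖ ≤ M * ‖h‖ := by
    intro w hw
    have hw' : ‖w - x‖ ≤ ‖h‖ := by simpa [dist_eq_norm] using hw
    have := (convex_closedBall x ‖h‖).norm_image_sub_le_of_norm_fderiv_le
      (f := fderiv ℝ f) (C := M) (x := x) (y := w) (𝕜 := ℝ) (fun z _ => hd2 z)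
      (fun z hz => by
        rw [norm_fderiv_fderiv_eq_norm_iteratedFDeriv_two]
        exact hM z ((by simpa [dist_eq_norm] using hz : ‖z - x‖ ≤ ‖h‖).trans hh))
      (Metric.mem_closedBall_self (norm_nonneg h)) hw
    exact this.trans (mul_le_mul_of_nonneg_left hw' hM0)
  have taylor : ∀ y ∈ Metric.closedBall x ‖h‖,
      ‖f y - f x - fderiv ℝ f x (y - x)‖ ≤ M * ‖h‖ * ‖y - x‖ := fun y hy =>
    (convex_closedBall x ‖h‖).norm_image_sub_le_of_norm_fderiv_le' (fun z _ => hd z)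
      grad (Metric.mem_closedBall_self (norm_nonneg h)) hy
  have h1 := taylor (x + h) (by simp)
  have h2 := taylor (x - h) (by simp)
  simp only [add_sub_cancel_left, sub_sub_cancel_left, norm_neg, map_neg, Real.norm_eq_abs] at h1 h2
  rw [abs_le] at *
  constructor <;> nlinarith [h1.1, h1.2, h2.1, h2.2]

/-- An integral is controlled by a majorant of the symmetrization of the integrand. -/
theorem abs_integral_le_of_symmetrized_le {E : Type*} [AddCommGroup E] [MeasurableSpace E]
    [MeasurableNeg E] {μ : Measure E} [μ.IsNegInvariant] {F G : E → ℝ} (hG : Integrable G μ)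
    (h : ∀ y, |F y + F (-y)| ≤ 2 * G y) : |∫ y, F y ∂μ| ≤ ∫ y, G y ∂μ := by
  have hG0 : 0 ≤ ∫ y, G y ∂μ :=
    integral_nonneg fun y => by
      have := (abs_nonneg _).trans (h y)
      simp only [Pi.zero_apply]
      linarith
  by_cases hF : Integrable F μ
  · have h1 : |∫ y, (F y + F (-y)) ∂μ| ≤ ∫ y, 2 * G y ∂μ :=
      norm_integral_le_of_norm_le (f := fun y => F y + F (-y)) (hG.const_mul 2)
        (Eventually.of_forall h)
    rw [integral_add hF hF.comp_neg, integral_neg_eq_self, integral_const_mul, ← two_mul,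
      abs_mul, abs_two] at h1
    linarith
  · rw [integral_undef hF, abs_zero]
    exact hG0

section PowerTailProfile

variable {N : ℕ} {p cψ : ℝ} {ψ : EuclideanSpace ℝ (Fin N) → ℝ}

theorem profile_nonneg (hψrad : ∀ x y, ‖x‖ ≤ ‖y‖ → ψ y ≤ ψ x)
    (hψ2 : ∀ z, 2 ≤ ‖z‖ → ψ z = ‖z‖ ^ (-p)) (hN : 1 ≤ N) (x : EuclideanSpace ℝ (Fin N)) :
    0 ≤ ψ x := by
  have : Nonempty (Fin N) := ⟨⟨0, hN⟩⟩
  obtain ⟨v, hv⟩ := exists_norm_eq (EuclideanSpace ℝ (Fin N)) (c := max 2 ‖x‖) (by positivity)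
  have h := hψrad x v (hv ▸ le_max_right _ _)
  rw [hψ2 v (hv ▸ le_max_left _ _)] at h
  exact (by positivity : (0:ℝ) ≤ ‖v‖ ^ (-p)).trans h

theorem profile_le_one (hψrad : ∀ x y, ‖x‖ ≤ ‖y‖ → ψ y ≤ ψ x)
    (hψ1 : ∀ z, ‖z‖ ≤ 1 → ψ z = 1) (x : EuclideanSpace ℝ (Fin N)) : ψ x ≤ 1 := by
  rw [← hψ1 0 (by simp)]
  exact hψrad 0 x (by simp)

theorem profile_le_rpow (hp : 0 < p) (hψrad : ∀ x y, ‖x‖ ≤ ‖y‖ → ψ y ≤ ψ x)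
    (hψ1 : ∀ z, ‖z‖ ≤ 1 → ψ z = 1) (hψ2 : ∀ z, 2 ≤ ‖z‖ → ψ z = ‖z‖ ^ (-p))
    (w : EuclideanSpace ℝ (Fin N)) : ψ w ≤ 2 ^ p * (max 1 ‖w‖) ^ (-p) := by
  rcases le_total 2 ‖w‖ with h | h
  · rw [hψ2 w h, max_eq_right (by linarith)]
    exact le_mul_of_one_le_left (by positivity) (Real.one_le_rpow (by norm_num) hp.le)
  · refine (profile_le_one hψrad hψ1 w).trans ?_
    have h2 : (2:ℝ) ^ (-p) ≤ (max 1 ‖w‖) ^ (-p) :=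
      Real.rpow_le_rpow_of_nonpos (by positivity) (max_le (by norm_num) h) (by linarith)
    calc (1:ℝ) = 2 ^ p * 2 ^ (-p) := by rw [← Real.rpow_add (by norm_num)]; simp
      _ ≤ _ := by gcongr

theorem rpow_le_profile (hN : 1 ≤ N) (hψrad : ∀ x y, ‖x‖ ≤ ‖y‖ → ψ y ≤ ψ x)
    (hψ2 : ∀ z, 2 ≤ ‖z‖ → ψ z = ‖z‖ ^ (-p)) (x : EuclideanSpace ℝ (Fin N)) :
    (max 1 (‖x‖ / 2)) ^ (-p) ≤ 2 ^ p * ψ x := by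
  have : Nonempty (Fin N) := ⟨⟨0, hN⟩⟩
  obtain ⟨v, hv⟩ := exists_norm_eq (EuclideanSpace ℝ (Fin N)) (c := 2 * max 1 (‖x‖ / 2))
    (by positivity)
  have h1 : 1 ≤ max 1 (‖x‖ / 2) := le_max_left _ _
  have h2 : ‖x‖ / 2 ≤ max 1 (‖x‖ / 2) := le_max_right _ _
  have h := hψrad x v (by rw [hv]; linarith)
  rw [hψ2 v (by rw [hv]; linarith), hv, Real.mul_rpow (by norm_num) (by positivity)] at h
  calc (max 1 (‖x‖ / 2)) ^ (-p) = 2 ^ p * (2 ^ (-p) * (max 1 (‖x‖ / 2)) ^ (-p)) := by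
        rw [← mul_assoc, ← Real.rpow_add (by norm_num)]; simp
    _ ≤ _ := by gcongr

theorem integrable_profile (hN : 1 ≤ N) (hp : (N:ℝ) < p) (hcont : Continuous ψ)
    (hψrad : ∀ x y, ‖x‖ ≤ ‖y‖ → ψ y ≤ ψ x) (hψ1 : ∀ z, ‖z‖ ≤ 1 → ψ z = 1)
    (hψ2 : ∀ z, 2 ≤ ‖z‖ → ψ z = ‖z‖ ^ (-p)) : Integrable ψ := by
  have hp0 : 0 < p := (Nat.cast_nonneg N).trans_lt hp
  have hI := integrable_one_add_norm (E := EuclideanSpace ℝ (Fin N)) (μ := volume) (r := p)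
    (by simpa using hp)
  refine (hI.const_mul (2 ^ p * 2 ^ p)).mono' hcont.aestronglyMeasurable
    (Eventually.of_forall fun w => ?_)
  rw [Real.norm_of_nonneg (profile_nonneg hψrad hψ2 hN w)]
  refine (profile_le_rpow hp0 hψrad hψ1 hψ2 w).trans ?_
  rw [mul_assoc]
  gcongr
  have h1 : 1 ≤ max 1 ‖w‖ := le_max_left _ _
  have h2 : ‖w‖ ≤ max 1 ‖w‖ := le_max_right _ _
  have h : (2 * max 1 ‖w‖) ^ (-p) ≤ (1 + ‖w‖) ^ (-p) :=
    Real.rpow_le_rpow_of_nonpos (by positivity) (by linarith) (by linarith)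
  rw [Real.mul_rpow (by norm_num) (by positivity)] at h
  calc (max 1 ‖w‖) ^ (-p) = 2 ^ p * (2 ^ (-p) * (max 1 ‖w‖) ^ (-p)) := by
        rw [← mul_assoc, ← Real.rpow_add (by norm_num)]; simp
    _ ≤ _ := by gcongr

theorem norm_hessian_profile_le (hN : 1 ≤ N) (hp : 0 < p)
    (hψrad : ∀ x y, ‖x‖ ≤ ‖y‖ → ψ y ≤ ψ x) (hψ1 : ∀ z, ‖z‖ ≤ 1 → ψ z = 1)
    (hψ2 : ∀ z, 2 ≤ ‖z‖ → ψ z = ‖z‖ ^ (-p))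
    (hψhess : ∀ x, x ≠ 0 → ‖iteratedFDeriv ℝ 2 ψ x‖ ≤ cψ * ‖x‖ ^ (-2:ℝ) * ψ x)
    (w : EuclideanSpace ℝ (Fin N)) :
    ‖iteratedFDeriv ℝ 2 ψ w‖ ≤ |cψ| * 2 ^ p * (max 1 ‖w‖) ^ (-2 - p) := by
  rcases lt_or_ge ‖w‖ 1 with h | h
  · have hloc : ψ =ᶠ[nhds w] fun _ => 1 := by
      filter_upwards [Metric.isOpen_ball.mem_nhds
        (show w ∈ Metric.ball (0 : EuclideanSpace ℝ (Fin N)) 1 by simpa using h)] with z hz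
      exact hψ1 z (by simpa using (mem_ball_zero_iff.1 hz).le)
    rw [(hloc.iteratedFDeriv ℝ 2).eq_of_nhds, iteratedFDeriv_const_of_ne (by norm_num)]
    simp only [Pi.zero_apply, norm_zero]
    positivity
  · have hw0 : 0 < ‖w‖ := by linarith
    have hψw := profile_le_rpow hp hψrad hψ1 hψ2 w
    rw [max_eq_right h] at hψw ⊢
    calc _ ≤ cψ * ‖w‖ ^ (-2:ℝ) * ψ w := hψhess w (norm_pos_iff.1 hw0)
      _ ≤ |cψ| * ‖w‖ ^ (-2:ℝ) * (2 ^ p * ‖w‖ ^ (-p)) := by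
        have := profile_nonneg hψrad hψ2 hN w
        gcongr
        exact le_abs_self _
      _ = _ := by
        rw [sub_eq_add_neg, Real.rpow_add hw0]
        ring

theorem norm_hessian_profile_le_of_near (hN : 1 ≤ N) (hp : 0 < p)
    (hψrad : ∀ x y, ‖x‖ ≤ ‖y‖ → ψ y ≤ ψ x) (hψ1 : ∀ z, ‖z‖ ≤ 1 → ψ z = 1)
    (hψ2 : ∀ z, 2 ≤ ‖z‖ → ψ z = ‖z‖ ^ (-p))
    (hψhess : ∀ x, x ≠ 0 → ‖iteratedFDeriv ℝ 2 ψ x‖ ≤ cψ * ‖x‖ ^ (-2:ℝ) * ψ x)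
    {x w : EuclideanSpace ℝ (Fin N)} (hw : ‖w - x‖ ≤ max 1 (‖x‖ / 2)) :
    ‖iteratedFDeriv ℝ 2 ψ w‖ ≤ |cψ| * 2 ^ p * (max 1 (‖x‖ / 2)) ^ (-2 - p) := by
  refine (norm_hessian_profile_le hN hp hψrad hψ1 hψ2 hψhess w).trans ?_
  refine mul_le_mul_of_nonneg_left (Real.rpow_le_rpow_of_nonpos (by positivity)
    (max_le (le_max_left _ _) ?_) (by linarith)) (by positivity)
  have htri : ‖x‖ - ‖w‖ ≤ ‖w - x‖ := by
    rw [norm_sub_rev]; exact norm_sub_norm_le x w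
  rcases le_total 1 (‖x‖ / 2) with h | h
  · rw [max_eq_right h] at hw
    exact (by linarith : ‖x‖ / 2 ≤ ‖w‖).trans (le_max_right _ _)
  · exact h.trans (le_max_left _ _)

end PowerTailProfile

theorem stmt10 (N : ℕ) (hN : 1 ≤ N) (γ c cψ : ℝ) (hγ : 0 < γ) (hγ2 : γ < 2) (hc : 0 < c)
    (J ψ : EuclideanSpace ℝ (Fin N) → ℝ)
    (hJ0 : ∀ z, 0 ≤ J z)
    (hJrad : ∀ z w, ‖z‖ = ‖w‖ → J z = J w)
    (hJmono : ∃ R₀ > (0:ℝ), ∀ z w, R₀ ≤ ‖z‖ → ‖z‖ ≤ ‖w‖ → J w ≤ J z)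
    (hlevy : Integrable (fun z => min 1 (‖z‖ ^ 2) * J z))
    (hJup : ∀ z, 1 < ‖z‖ → J z ≤ c * ‖z‖ ^ (-((N:ℝ) + γ)))
    (hψsmooth : ContDiff ℝ 2 ψ)
    (hψrad : ∀ x y, ‖x‖ ≤ ‖y‖ → ψ y ≤ ψ x)
    (hψ1 : ∀ z, ‖z‖ ≤ 1 → ψ z = 1)
    (hψ2 : ∀ z, 2 ≤ ‖z‖ → ψ z = ‖z‖ ^ (-((N:ℝ) + γ)))
    (hψhess : ∀ x, x ≠ 0 → ‖iteratedFDeriv ℝ 2 ψ x‖ ≤ cψ * ‖x‖ ^ (-2:ℝ) * ψ x) :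
    ∃ C > (0:ℝ), ∀ A : ℝ, 2 < A →
      ∀ Lφ : EuclideanSpace ℝ (Fin N) → ℝ,
        (∀ x, Tendsto (fun ε : ℝ =>
            ∫ z in {z | ε < ‖x - z‖}, (ψ (A⁻¹ • x) - ψ (A⁻¹ • z)) * J (x - z))
          (nhdsWithin 0 (Ioi 0)) (nhds (Lφ x))) →
        ∀ x, |Lφ x| ≤ C * A ^ (-γ) * ψ (A⁻¹ • x) := by
  obtain ⟨K₁, hK₁, hnear⟩ := exists_integral_norm_rpow_ball hN hγ2
  obtain ⟨K₂, hK₂, hfar⟩ := exists_integral_norm_rpow_tail hN hγ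
  have hNpos : (0:ℝ) < N := by exact_mod_cast hN
  set p : ℝ := (N:ℝ) + γ with hpdef
  have hp : 0 < p := by positivity
  have hψ0 := profile_nonneg hψrad hψ2 hN
  have hψint := integrable_profile hN (by linarith) hψsmooth.continuous hψrad hψ1 hψ2
  set Λ : ℝ := ∫ z, min 1 (‖z‖ ^ 2) * J z with hΛ
  set I : ℝ := ∫ z, ψ z with hI
  have hΛ0 : 0 ≤ Λ := integral_nonneg fun z => mul_nonneg (by positivity) (hJ0 z)
  have hI0 : 0 ≤ I := integral_nonneg hψ0
  refine ⟨|cψ| * 2 ^ p * (Λ + c * K₁) * 2 ^ p + c * K₂ + c * I * 2 ^ p + 1, by positivity,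
    fun A hA Lφ hL x => ?_⟩
  have hA0 : 0 < A := by linarith
  set ξ := A⁻¹ • x with hξ
  set ρ : ℝ := max 1 (‖ξ‖ / 2) with hρ
  have hρ1 : 1 ≤ ρ := le_max_left _ _
  have hρ0 : 0 < ρ := by linarith
  set R : ℝ := A * ρ with hR
  have hR1 : 1 < R := by nlinarith
  have hR0 : 0 < R := by linarith
  set M : ℝ := |cψ| * 2 ^ p * ρ ^ (-2 - p) with hM
  have hM0 : 0 ≤ M := by positivity
  obtain ⟨hn1, hn2⟩ := hnear R hR0
  obtain ⟨hf1, hf2⟩ := hfar R hR0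
  let G : EuclideanSpace ℝ (Fin N) → ℝ := fun y =>
    M * A⁻¹ ^ 2 * (min 1 (‖y‖ ^ 2) * J y
      + c * (Iic R).indicator (fun r : ℝ => r ^ (2 - p)) ‖y‖)
    + ψ ξ * c * (Ioi R).indicator (fun r : ℝ => r ^ (-p)) ‖y‖
    + c * R ^ (-p) / 2 * (ψ (A⁻¹ • (x - y)) + ψ (A⁻¹ • (x + y)))
  have hs0 : Integrable (fun y => ψ (A⁻¹ • y)) := hψint.comp_smul (inv_ne_zero hA0.ne')
  have hs1 : Integrable (fun y => ψ (A⁻¹ • (x - y))) := hs0.comp_sub_left x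
  have hs2 : Integrable (fun y => ψ (A⁻¹ • (x + y))) := hs0.comp_add_left x
  have hi1 : Integrable (fun y => M * A⁻¹ ^ 2 * (min 1 (‖y‖ ^ 2) * J y
      + c * (Iic R).indicator (fun r : ℝ => r ^ (2 - p)) ‖y‖)) :=
    (hlevy.add (hn1.const_mul c)).const_mul _
  have hi2 := hf1.const_mul (ψ ξ * c)
  have hi3 : Integrable (fun y => c * R ^ (-p) / 2 * (ψ (A⁻¹ • (x - y)) + ψ (A⁻¹ • (x + y)))) :=
    (hs1.add hs2).const_mul _
  have hi12 : Integrable (fun y => M * A⁻¹ ^ 2 * (min 1 (‖y‖ ^ 2) * J y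
      + c * (Iic R).indicator (fun r : ℝ => r ^ (2 - p)) ‖y‖)
      + ψ ξ * c * (Ioi R).indicator (fun r : ℝ => r ^ (-p)) ‖y‖) := hi1.add hi2
  have hGint : Integrable G := hi12.add hi3
  have hscale : ∫ y, ψ (A⁻¹ • y) = A ^ N * I := by
    rw [Measure.integral_comp_inv_smul_of_nonneg volume ψ hA0.le]
    simp [hI]
  have hGval : ∫ y, G y = M * A⁻¹ ^ 2 * (Λ + c * (K₁ * R ^ (2 - γ)))
      + ψ ξ * c * (K₂ * R ^ (-γ)) + c * R ^ (-p) * (A ^ N * I) := by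
    have e1 : ∫ y, ψ (A⁻¹ • (x - y)) = A ^ N * I := by
      rw [← hscale]
      exact integral_sub_left_eq_self (fun y => ψ (A⁻¹ • y)) volume x
    have e2 : ∫ y, ψ (A⁻¹ • (x + y)) = A ^ N * I := by
      rw [← hscale]
      exact integral_add_left_eq_self (fun y => ψ (A⁻¹ • y)) x
    simp only [G]
    rw [integral_add hi12 hi3, integral_add hi1 hi2, integral_const_mul,
      integral_add hlevy (hn1.const_mul c), integral_const_mul, integral_const_mul,
      integral_const_mul, integral_add hs1 hs2, e1, e2, hn2, hf2]
    ring
  have hbound : ∫ y, G y ≤ (|cψ| * 2 ^ p * (Λ + c * K₁) * 2 ^ p + c * K₂ + c * I * 2 ^ p + 1)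
      * A ^ (-γ) * ψ ξ := by
    have hρψ : ρ ^ (-p) ≤ 2 ^ p * ψ ξ := rpow_le_profile hN hψrad hψ2 ξ
    have hργ : ρ ^ (-γ) ≤ 1 := Real.rpow_le_one_of_one_le_of_nonpos hρ1 (by linarith)
    have t1 : M * A⁻¹ ^ 2 * (Λ + c * (K₁ * R ^ (2 - γ)))
        ≤ |cψ| * 2 ^ p * (Λ + c * K₁) * 2 ^ p * A ^ (-γ) * ψ ξ := by
      have hRge : 1 ≤ R ^ (2 - γ) := Real.one_le_rpow hR1.le (by linarith)
      have hΛR : Λ ≤ Λ * R ^ (2 - γ) := le_mul_of_one_le_right hΛ0 hRge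
      have hpow : ρ ^ (-2 - p) * A⁻¹ ^ 2 * R ^ (2 - γ) = ρ ^ (-γ) * ρ ^ (-p) * A ^ (-γ) := by
        have a2 : A⁻¹ ^ 2 = A ^ (-2:ℝ) := by
          rw [Real.rpow_neg hA0.le, inv_pow]; norm_cast
        rw [hR, Real.mul_rpow hA0.le hρ0.le, a2]
        calc _ = (ρ ^ (-2 - p) * ρ ^ (2 - γ)) * (A ^ (-2:ℝ) * A ^ (2 - γ)) := by ring
          _ = _ := by
            rw [← Real.rpow_add hρ0, ← Real.rpow_add hA0, ← Real.rpow_add hρ0]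
            ring_nf
      calc M * A⁻¹ ^ 2 * (Λ + c * (K₁ * R ^ (2 - γ)))
          ≤ M * A⁻¹ ^ 2 * (Λ * R ^ (2 - γ) + c * (K₁ * R ^ (2 - γ))) := by gcongr
        _ = |cψ| * 2 ^ p * (Λ + c * K₁) * (ρ ^ (-2 - p) * A⁻¹ ^ 2 * R ^ (2 - γ)) := by
          rw [hM]; ring
        _ = |cψ| * 2 ^ p * (Λ + c * K₁) * (ρ ^ (-γ) * ρ ^ (-p) * A ^ (-γ)) := by rw [hpow]
        _ ≤ |cψ| * 2 ^ p * (Λ + c * K₁) * (1 * (2 ^ p * ψ ξ) * A ^ (-γ)) := by gcongr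
        _ = _ := by ring
    have t2 : ψ ξ * c * (K₂ * R ^ (-γ)) ≤ c * K₂ * A ^ (-γ) * ψ ξ := by
      have h := hψ0 ξ
      rw [hR, Real.mul_rpow hA0.le hρ0.le]
      calc ψ ξ * c * (K₂ * (A ^ (-γ) * ρ ^ (-γ))) ≤ ψ ξ * c * (K₂ * (A ^ (-γ) * 1)) := by gcongr
        _ = _ := by ring
    have t3 : c * R ^ (-p) * (A ^ N * I) ≤ c * I * 2 ^ p * A ^ (-γ) * ψ ξ := by
      have hpow : A ^ (-p) * A ^ N = A ^ (-γ) := by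
        rw [← Real.rpow_natCast, ← Real.rpow_add hA0, hpdef]
        ring_nf
      rw [hR, Real.mul_rpow hA0.le hρ0.le]
      calc c * (A ^ (-p) * ρ ^ (-p)) * (A ^ N * I)
          = c * I * (A ^ (-p) * A ^ N) * ρ ^ (-p) := by ring
        _ = c * I * A ^ (-γ) * ρ ^ (-p) := by rw [hpow]
        _ ≤ c * I * A ^ (-γ) * (2 ^ p * ψ ξ) := by gcongr
        _ = _ := by ring
    have t4 : 0 ≤ A ^ (-γ) * ψ ξ := mul_nonneg (by positivity) (hψ0 ξ)
    rw [hGval]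
    linarith
  have hpoint : ∀ y, |(ψ ξ - ψ (A⁻¹ • (x - y))) + (ψ ξ - ψ (A⁻¹ • (x + y)))| * J y
      ≤ 2 * G y := by
    intro y
    have hJy := hJ0 y
    have hm : 0 ≤ ψ (A⁻¹ • (x - y)) := hψ0 _
    have hq : 0 ≤ ψ (A⁻¹ • (x + y)) := hψ0 _
    have hx0 : 0 ≤ ψ ξ := hψ0 ξ
    rcases le_or_gt ‖y‖ R with hy | hy
    · have hη : ‖A⁻¹ • y‖ = A⁻¹ * ‖y‖ := by
        rw [norm_smul, Real.norm_of_nonneg (by positivity)]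
      have hsd := abs_second_difference_le hψsmooth (x := ξ) (ρ := ρ) (M := M)
        (fun w hw => norm_hessian_profile_le_of_near hN hp hψrad hψ1 hψ2 hψhess hw)
        (h := A⁻¹ • y) (by rw [hη, inv_mul_le_iff₀ hA0]; exact hy)
      rw [hη, hξ, ← smul_sub, ← smul_add] at hsd
      have hker : ‖y‖ ^ 2 * J y ≤ min 1 (‖y‖ ^ 2) * J y + c * ‖y‖ ^ (2 - p) := by
        rcases le_or_gt ‖y‖ 1 with h1 | h1
        · rw [min_eq_right (by nlinarith [norm_nonneg y])]
          have : 0 ≤ c * ‖y‖ ^ (2 - p) := by positivity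
          linarith
        · have hy0 : 0 < ‖y‖ := by linarith
          have : ‖y‖ ^ 2 * J y ≤ c * ‖y‖ ^ (2 - p) := by
            calc ‖y‖ ^ 2 * J y ≤ ‖y‖ ^ 2 * (c * ‖y‖ ^ (-p)) := by gcongr; exact hJup y h1
              _ = c * ‖y‖ ^ (2 - p) := by
                rw [sub_eq_add_neg, Real.rpow_add hy0, Real.rpow_two]; ring
          have : 0 ≤ min 1 (‖y‖ ^ 2) * J y := mul_nonneg (by positivity) hJy
          linarith
      have hrest : 0 ≤ c * R ^ (-p) / 2 * (ψ (A⁻¹ • (x - y)) + ψ (A⁻¹ • (x + y))) := by positivity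
      have hGy : M * A⁻¹ ^ 2 * (‖y‖ ^ 2 * J y) ≤ G y := by
        simp only [G]
        rw [indicator_of_mem (show ‖y‖ ∈ Iic R from hy),
          indicator_of_notMem (show ‖y‖ ∉ Ioi R from not_lt.2 hy)]
        have := mul_le_mul_of_nonneg_left hker (show 0 ≤ M * A⁻¹ ^ 2 by positivity)
        linarith
      calc _ ≤ 2 * M * (A⁻¹ * ‖y‖) ^ 2 * J y := mul_le_mul_of_nonneg_right hsd hJy
        _ = 2 * (M * A⁻¹ ^ 2 * (‖y‖ ^ 2 * J y)) := by ring
        _ ≤ 2 * G y := by linarith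
    · have hJle := hJup y (hR1.trans hy)
      have hpowle : ‖y‖ ^ (-p) ≤ R ^ (-p) :=
        Real.rpow_le_rpow_of_nonpos hR0 hy.le (by linarith)
      have hJR : J y ≤ c * R ^ (-p) := hJle.trans (by gcongr)
      have habs : |(ψ ξ - ψ (A⁻¹ • (x - y))) + (ψ ξ - ψ (A⁻¹ • (x + y)))|
          ≤ 2 * ψ ξ + (ψ (A⁻¹ • (x - y)) + ψ (A⁻¹ • (x + y))) := by
        rw [abs_le]; constructor <;> linarith
      have hnn : 0 ≤ M * A⁻¹ ^ 2 * (min 1 (‖y‖ ^ 2) * J y) := by positivity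
      simp only [G]
      rw [indicator_of_notMem (show ‖y‖ ∉ Iic R from not_le.2 hy),
        indicator_of_mem (show ‖y‖ ∈ Ioi R from hy)]
      have u1 := mul_le_mul_of_nonneg_right habs hJy
      have u2 : 2 * ψ ξ * J y ≤ 2 * ψ ξ * (c * ‖y‖ ^ (-p)) := by gcongr
      have u3 : (ψ (A⁻¹ • (x - y)) + ψ (A⁻¹ • (x + y))) * J y
          ≤ (ψ (A⁻¹ • (x - y)) + ψ (A⁻¹ • (x + y))) * (c * R ^ (-p)) := by gcongr
      linarith
  refine le_of_tendsto (hL x).abs (Eventually.of_forall fun ε => ?_)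
  refine le_trans ?_ hbound
  let F : EuclideanSpace ℝ (Fin N) → ℝ :=
    {y | ε < ‖y‖}.indicator fun y => (ψ ξ - ψ (A⁻¹ • (x - y))) * J y
  have hset : ∫ z in {z | ε < ‖x - z‖}, (ψ (A⁻¹ • x) - ψ (A⁻¹ • z)) * J (x - z) = ∫ y, F y := by
    rw [← integral_indicator (measurableSet_lt measurable_const (by fun_prop)),
      ← integral_sub_left_eq_self F volume x]
    congr 1 with z
    simp only [F, indicator, mem_ofPred_eq, sub_sub_cancel, hξ]
  rw [hset]
  refine abs_integral_le_of_symmetrized_le hGint fun y => ?_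
  have hp2 := hpoint y
  by_cases hy : ε < ‖y‖
  · simp only [F, indicator, mem_ofPred_eq, norm_neg, hy, if_true, sub_neg_eq_add,
      hJrad (-y) y (norm_neg y)]
    rwa [← add_mul, abs_mul, abs_of_nonneg (hJ0 y)]
  · simp only [F, indicator, mem_ofPred_eq, norm_neg, hy, if_false, add_zero, abs_zero]
    exact (mul_nonneg (abs_nonneg _) (hJ0 y)).trans hp2
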